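/- Let L(λ) := M_{τ_1}(Y_1) M_{σ_1}(X_1) (λ M_τ^P − M_σ^P) M_{σ_2}(X_2) M_{τ_2}(Y_2) be an EGFP of P(λ), and suppose 0 ∈ ω (where τ = −ω). Then: (a) if c_0(ω)+1 ∈ σ and s := c_0(ω) + i_{c_0(ω)+1}(σ) + 1 < m, then M_{τ_1}(Y_1) M_{σ_1}(X_1) (e_{m−s} ⊗ I_n) = e_{m−p} ⊗ I_n, where p := c_0(ω) + i_{c_0(ω)+1}(σ_1,σ) + 1; (b) if c_0(ω)+1 ∈ σ and c_0(ω) + i_{c_0(ω)+1}(σ) + 1 = m, then M_{τ_1}(Y_1) M_{σ_1}(X_1) (e_1 ⊗ I_n) = e_p ⊗ I_n, where p := i_{−(m−1)}(τ_1) + 2; (c) if c_0(ω) < m and c_0(ω)+1 ∉ σ, then M_{τ_1}(Y_1) M_{σ_1}(X_1) (e_{m−c_0(ω)} ⊗ I_n) = e_{m−p} ⊗ I_n, where p := c_0(ω) − i_{−c_0(ω)}(τ_1) − 1; (d) if c_0(ω) = m, then M_{τ_1}(Y_1) M_{σ_1}(X_1) (e_m ⊗ I_n) = e_m ⊗ I_n.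 -/

import Mathlib

open Matrix Polynomial

/-- Signed indices: `pos k` denotes `k` and `neg k` denotes `−k`, with `−0` and `0` distinct. -/
inductive SIdx : Type where
  | pos : ℕ → SIdx
  | neg : ℕ → SIdx
deriving DecidableEq

namespace SIdx

/-- The absolute value of a signed index. -/
def val : SIdx → ℕ
  | pos k => k
  | neg k => k

/-- Whether a signed index is negative. -/
def isNeg : SIdx → Bool
  | pos _ => false
  | neg _ => true

/-- The successor `t + 1` of a signed index (`−s + 1 = −(s−1)`). -/
def succ : SIdx → SIdx
  | pos k => pos (k + 1)
  | neg 0 => pos 0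
  | neg (k + 1) => neg k

/-- Negation of a signed index. -/
def negate : SIdx → SIdx
  | pos k => neg k
  | neg k => pos k

end SIdx

/-- The ascending chain `(t, t+1, …, t+p)`. -/
def chainUp (t : SIdx) : ℕ → List SIdx
  | 0 => [t]
  | p + 1 => t :: chainUp t.succ p

/-- The number of consecutions `c_t(α)` of the index tuple `α` at `t` (`−1` when `t ∉ α`):
the largest `p` such that `(t, t+1, …, t+p)` is a subtuple (sublist) of `α`. -/
noncomputable def consAt (α : List SIdx) (t : SIdx) : ℤ :=
  letI := Classical.decPred (fun p : ℕ => (chainUp t p).Sublist α)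
  if t ∈ α then (Nat.findGreatest (fun p : ℕ => (chainUp t p).Sublist α) α.length : ℤ) else -1

/-- The number of inversions `i_t(α)` of the index tuple `α` at `t` (`−1` when `t ∉ α`):
the largest `q` such that `(t+q, …, t+1, t)` is a subtuple (sublist) of `α`. -/
noncomputable def invsAt (α : List SIdx) (t : SIdx) : ℤ :=
  letI := Classical.decPred (fun p : ℕ => ((chainUp t p).reverse).Sublist α)
  if t ∈ α then (Nat.findGreatest (fun p : ℕ => ((chainUp t p).reverse).Sublist α) α.length : ℤ)
  else -1

/-- The Successor Infix Property: between any two equal entries there is an occurrence of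
their successor. -/
def SIP (α : List SIdx) : Prop :=
  ∀ a b : Fin α.length, a < b → α.get a = α.get b →
    ∃ c : Fin α.length, a < c ∧ c < b ∧ α.get c = (α.get a).succ

/-- The `mn × mn` elementary matrix `M_k(X)` (viewed as an `m × m` block matrix with
`n × n` blocks): `M_0(X) = M_{−0}(X) = diag(I_{(m−1)n}, X)`,
`M_m(X) = M_{−m}(X) = diag(X, I_{(m−1)n})`, and for `1 ≤ i ≤ m−1` the matrix `M_i(X)`
(resp. `M_{−i}(X)`) is the identity except for the 2×2 block submatrix
`[[X, I],[I, 0]]` (resp. `[[0, I],[I, X]]`) in block rows/columns `(m−i, m−i+1)`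
(1-indexed). -/
noncomputable def elemMat (m n : ℕ) (k : SIdx) (X : Matrix (Fin n) (Fin n) ℂ) :
    Matrix (Fin m × Fin n) (Fin m × Fin n) ℂ := fun p q =>
  if k.val = 0 then
    if p.1 = q.1 then (if (p.1 : ℕ) = m - 1 then X p.2 q.2 else if p.2 = q.2 then 1 else 0)
    else 0
  else if k.val = m then
    if p.1 = q.1 then (if (p.1 : ℕ) = 0 then X p.2 q.2 else if p.2 = q.2 then 1 else 0)
    else 0
  else
    if (p.1 : ℕ) = m - k.val - 1 ∧ (q.1 : ℕ) = m - k.val - 1 then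
      (if k.isNeg then 0 else X p.2 q.2)
    else if ((p.1 : ℕ) = m - k.val - 1 ∧ (q.1 : ℕ) = m - k.val) ∨
        ((p.1 : ℕ) = m - k.val ∧ (q.1 : ℕ) = m - k.val - 1) then
      (if p.2 = q.2 then 1 else 0)
    else if (p.1 : ℕ) = m - k.val ∧ (q.1 : ℕ) = m - k.val then
      (if k.isNeg then X p.2 q.2 else 0)
    else if p = q then 1 else 0

/-- `M_t(X) = M_{t_1}(X_1) ⋯ M_{t_r}(X_r)` for an index tuple `t` with matrix assignment `Xs`. -/
noncomputable def prodAssign (m n : ℕ) (t : List SIdx) (Xs : List (Matrix (Fin n) (Fin n) ℂ)) :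
    Matrix (Fin m × Fin n) (Fin m × Fin n) ℂ :=
  ((t.zip Xs).map fun p => elemMat m n p.1 p.2).prod

/-- The trivial (Fiedler) matrix assignment of `P(λ) = Σ λ^i A_i`:
`M_i^P = M_i(−A_i)` for `0 ≤ i ≤ m−1`, `M_m^P = (M_{−m}^P)⁻¹ = M_m(A_m⁻¹)`,
`M_{−i}^P = M_{−i}(A_i)` for `1 ≤ i ≤ m`, and `M_{−0}^P = (M_0^P)⁻¹ = M_{−0}((−A_0)⁻¹)`. -/
noncomputable def fiedlerX (m : ℕ) {n : ℕ} (A : ℕ → Matrix (Fin n) (Fin n) ℂ) :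
    SIdx → Matrix (Fin n) (Fin n) ℂ
  | .pos i => if i = m then (A m)⁻¹ else -A i
  | .neg i => if i = 0 then (-A 0)⁻¹ else A i

/-- `M_t^P`, the product of Fiedler matrices of `P` along the index tuple `t`. -/
noncomputable def prodFiedler (m n : ℕ) (A : ℕ → Matrix (Fin n) (Fin n) ℂ) (t : List SIdx) :
    Matrix (Fin m × Fin n) (Fin m × Fin n) ℂ :=
  (t.map fun k => elemMat m n k (fiedlerX m A k)).prod

/-- A nonsingular matrix assignment: the matrices assigned to positions with indices
`±0` or `±m` are nonsingular. -/
def NonsingAssign (m : ℕ) {n : ℕ} (t : List SIdx) (Xs : List (Matrix (Fin n) (Fin n) ℂ)) :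
    Prop :=
  t.length = Xs.length ∧ ∀ p ∈ t.zip Xs, (p.1.val = 0 ∨ p.1.val = m) → IsUnit p.2

/-- The data of an extended generalized Fiedler pencil (EGFP)
`L(λ) = M_{τ₁}(Y₁) M_{σ₁}(X₁) (λ M_τ^P − M_σ^P) M_{σ₂}(X₂) M_{τ₂}(Y₂)`
of the `n × n` matrix polynomial `P(λ) = Σ_{i=0}^m λ^i A_i` of degree `m ≥ 2`. -/
structure EGFPData (m n : ℕ) where
  /-- coefficients of `P` -/
  A : ℕ → Matrix (Fin n) (Fin n) ℂ
  sig : List SIdx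
  tau : List SIdx
  sig1 : List SIdx
  sig2 : List SIdx
  tau1 : List SIdx
  tau2 : List SIdx
  X1 : List (Matrix (Fin n) (Fin n) ℂ)
  X2 : List (Matrix (Fin n) (Fin n) ℂ)
  Y1 : List (Matrix (Fin n) (Fin n) ℂ)
  Y2 : List (Matrix (Fin n) (Fin n) ℂ)
  hm : 2 ≤ m
  hAm : A m ≠ 0
  hsigpos : ∀ k ∈ sig, k.isNeg = false
  htauneg : ∀ k ∈ tau, k.isNeg = true
  /-- `(σ, ω)` is a permutation of `{0, 1, …, m}`, where `τ = −ω`. -/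
  hperm : List.Perm (sig.map SIdx.val ++ tau.map SIdx.val) (List.range (m + 1))
  hsig1 : ∀ k ∈ sig1, k ∈ sig ∧ k.val + 2 ≤ m
  hsig2 : ∀ k ∈ sig2, k ∈ sig ∧ k.val + 2 ≤ m
  htau1 : ∀ k ∈ tau1, k ∈ tau ∧ 2 ≤ k.val
  htau2 : ∀ k ∈ tau2, k ∈ tau ∧ 2 ≤ k.val
  hSIPsig : SIP (sig1 ++ sig ++ sig2)
  hSIPtau : SIP (tau1 ++ tau ++ tau2)
  hX1 : NonsingAssign m sig1 X1
  hX2 : NonsingAssign m sig2 X2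
  hY1 : NonsingAssign m tau1 Y1
  hY2 : NonsingAssign m tau2 Y2
  hA0 : SIdx.neg 0 ∈ tau → IsUnit (A 0)
  hAmUnit : SIdx.pos m ∈ sig → IsUnit (A m)

namespace EGFPData

variable {m n : ℕ}

/-- `M_{τ₁}(Y₁) M_{σ₁}(X₁)`. -/
noncomputable def leftFac (E : EGFPData m n) : Matrix (Fin m × Fin n) (Fin m × Fin n) ℂ :=
  prodAssign m n E.tau1 E.Y1 * prodAssign m n E.sig1 E.X1

/-- `M_{σ₂}(X₂) M_{τ₂}(Y₂)`. -/
noncomputable def rightFac (E : EGFPData m n) : Matrix (Fin m × Fin n) (Fin m × Fin n) ℂ :=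
  prodAssign m n E.sig2 E.X2 * prodAssign m n E.tau2 E.Y2

/-- The coefficient `L₁` of `λ` in `L(λ) = λ L₁ − L₀`. -/
noncomputable def L1 (E : EGFPData m n) : Matrix (Fin m × Fin n) (Fin m × Fin n) ℂ :=
  E.leftFac * prodFiedler m n E.A E.tau * E.rightFac

/-- The constant term `L₀` in `L(λ) = λ L₁ − L₀`. -/
noncomputable def L0 (E : EGFPData m n) : Matrix (Fin m × Fin n) (Fin m × Fin n) ℂ :=
  E.leftFac * prodFiedler m n E.A E.sig * E.rightFac

end EGFPData

/-- The `(i, j)` block (of size `n × n`) of an `mn × mn` matrix. -/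
def blockOf {m n : ℕ} (M : Matrix (Fin m × Fin n) (Fin m × Fin n) ℂ) (i j : Fin m) :
    Matrix (Fin n) (Fin n) ℂ := fun p q => M (i, p) (j, q)

/-- Block penta-diagonal: all blocks `B_{ij}` with `|i − j| > 2` vanish. -/
def BlockPenta {m n : ℕ} (M : Matrix (Fin m × Fin n) (Fin m × Fin n) ℂ) : Prop :=
  ∀ i j : Fin m, ((i : ℕ) + 2 < (j : ℕ) ∨ (j : ℕ) + 2 < (i : ℕ)) → blockOf M i j = 0

/-- Block tridiagonal: all blocks `B_{ij}` with `|i − j| > 1` vanish. -/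
def BlockTri {m n : ℕ} (M : Matrix (Fin m × Fin n) (Fin m × Fin n) ℂ) : Prop :=
  ∀ i j : Fin m, ((i : ℕ) + 1 < (j : ℕ) ∨ (j : ℕ) + 1 < (i : ℕ)) → blockOf M i j = 0

/-- `e_j^T ⊗ I_n` as an `n × mn` matrix, for a 1-indexed block index `j`
(zero when `j` is out of range). -/
def rowSel (m n : ℕ) (j : ℤ) : Matrix (Fin n) (Fin m × Fin n) ℂ :=
  fun p q => if ((q.1 : ℕ) : ℤ) + 1 = j ∧ p = q.2 then 1 else 0

/-- `e_j ⊗ I_n` as an `mn × n` matrix, for a 1-indexed block index `j`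
(zero when `j` is out of range). -/
def colSel (m n : ℕ) (j : ℤ) : Matrix (Fin m × Fin n) (Fin n) ℂ :=
  fun p q => if ((p.1 : ℕ) : ℤ) + 1 = j ∧ p.2 = q then 1 else 0

/-- The matrix polynomial `P(λ) = Σ_{i=0}^m λ^i A_i` as an `n × n` matrix over `ℂ[λ]`. -/
noncomputable def polyP (m n : ℕ) (A : ℕ → Matrix (Fin n) (Fin n) ℂ) :
    Matrix (Fin n) (Fin n) (Polynomial ℂ) := fun p q =>
  ∑ i ∈ Finset.range (m + 1), Polynomial.C (A i p q) * Polynomial.X ^ i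

namespace EGFPAux

theorem mul_colSel {m n : ℕ} (M : Matrix (Fin m × Fin n) (Fin m × Fin n) ℂ) (l : ℕ) (hl : l < m)
    (x : Fin m × Fin n) (q : Fin n) :
    (M * colSel m n ((m : ℤ) - (l : ℤ))) x q = M x (⟨m - 1 - l, by omega⟩, q) := by
  rw [Matrix.mul_apply, Finset.sum_eq_single (⟨m - 1 - l, by omega⟩, q)]
  · have : ((m - 1 - l : ℕ) : ℤ) + 1 = (m : ℤ) - l := by omega
    simp [colSel, this]
  · rintro ⟨b1, b2⟩ _ hb
    have : ¬ (((b1 : ℕ) : ℤ) + 1 = (m : ℤ) - l ∧ b2 = q) := by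
      rintro ⟨h1, h2⟩
      apply hb
      subst h2
      ext1
      · apply Fin.ext
        show (b1 : ℕ) = m - 1 - l
        omega
      · rfl
    simp only [colSel]
    rw [if_neg this, mul_zero]
  · simp

theorem elem_pos {m n : ℕ} (i : ℕ) (h1 : 1 ≤ i) (h2 : i < m) (X : Matrix (Fin n) (Fin n) ℂ) :
    elemMat m n (.pos i) X * colSel m n ((m : ℤ) - ((i - 1 : ℕ) : ℤ)) =
      colSel m n ((m : ℤ) - (i : ℤ)) := by
  ext ⟨x1, x2⟩ q
  rw [mul_colSel _ _ (by omega)]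
  have e0 : ¬ i = 0 := by omega
  have e1 : ¬ i = m := by omega
  have hx := x1.2
  simp only [elemMat, colSel, SIdx.val, SIdx.isNeg, e0, e1, if_false, Prod.mk.injEq, Fin.ext_iff]
  split_ifs <;> first | rfl | (exfalso; omega)

theorem elem_neg {m n : ℕ} (i : ℕ) (h1 : 1 ≤ i) (h2 : i < m) (X : Matrix (Fin n) (Fin n) ℂ) :
    elemMat m n (.neg i) X * colSel m n ((m : ℤ) - (i : ℤ)) =
      colSel m n ((m : ℤ) - ((i - 1 : ℕ) : ℤ)) := by
  ext ⟨x1, x2⟩ q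
  rw [mul_colSel _ _ (by omega)]
  have e0 : ¬ i = 0 := by omega
  have e1 : ¬ i = m := by omega
  have hx := x1.2
  simp only [elemMat, colSel, SIdx.val, SIdx.isNeg, e0, e1, if_false, Prod.mk.injEq, Fin.ext_iff]
  split_ifs <;> first | rfl | (exfalso; omega)

theorem elem_id {m n : ℕ} (k : SIdx) (l : ℕ) (hk : k.val ≤ m) (hl : l < m) (h1 : k.val ≠ l)
    (h2 : k.val ≠ l + 1) (X : Matrix (Fin n) (Fin n) ℂ) :
    elemMat m n k X * colSel m n ((m : ℤ) - (l : ℤ)) = colSel m n ((m : ℤ) - (l : ℤ)) := by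
  ext ⟨x1, x2⟩ q
  rw [mul_colSel _ _ hl]
  have hx := x1.2
  simp only [elemMat, colSel, Prod.mk.injEq, Fin.ext_iff]
  split_ifs <;> first | rfl | (exfalso; omega)

theorem prod_cons {m n : ℕ} (k : SIdx) (α : List SIdx) (X : Matrix (Fin n) (Fin n) ℂ)
    (Xs : List (Matrix (Fin n) (Fin n) ℂ)) :
    prodAssign m n (k :: α) (X :: Xs) = elemMat m n k X * prodAssign m n α Xs := by
  simp [prodAssign]

theorem prod_id {m n : ℕ} (l : ℕ) (hl : l < m) (α : List SIdx) :
    ∀ Xs : List (Matrix (Fin n) (Fin n) ℂ),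
    (∀ k ∈ α, k.val ≤ m ∧ k.val ≠ l ∧ k.val ≠ l + 1) →
    prodAssign m n α Xs * colSel m n ((m : ℤ) - (l : ℤ)) = colSel m n ((m : ℤ) - (l : ℤ)) := by
  induction α with
  | nil => intro Xs _; simp [prodAssign]
  | cons k α ih =>
    intro Xs h
    cases Xs with
    | nil => simp [prodAssign]
    | cons X Xs =>
      obtain ⟨a, b, c⟩ := h k (by simp)
      rw [prod_cons, Matrix.mul_assoc, ih Xs (fun k hk => h k (by simp [hk])),
        elem_id k l a hl b c]

/-- Greedy count from the right of the chain `t, t+1, …`. -/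
def cnt (t : SIdx) : List SIdx → ℕ
  | [] => 0
  | k :: α => if k = SIdx.succ^[cnt t α] t then cnt t α + 1 else cnt t α

def dchain (t : SIdx) : ℕ → List SIdx
  | 0 => []
  | p + 1 => SIdx.succ^[p] t :: dchain t p

theorem dchain_length (t : SIdx) (p : ℕ) : (dchain t p).length = p := by
  induction p with
  | zero => rfl
  | succ p ih => simp [dchain, ih]

theorem dchain_succ' (t : SIdx) (p : ℕ) : dchain t (p + 1) = dchain t.succ p ++ [t] := by
  induction p with
  | zero => rfl
  | succ p ih => rw [dchain, ih, dchain, Function.iterate_succ_apply]; rfl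

theorem chainUp_reverse (p : ℕ) : ∀ t : SIdx, (chainUp t p).reverse = dchain t (p + 1) := by
  induction p with
  | zero => intro t; rfl
  | succ p ih => intro t; rw [chainUp, List.reverse_cons, ih, ← dchain_succ']

theorem dchain_sublist (t : SIdx) (α : List SIdx) :
    ∀ q, (dchain t q).Sublist α ↔ q ≤ cnt t α := by
  induction α with
  | nil => intro q; cases q <;> simp [dchain, cnt]
  | cons k α ih =>
    intro q
    cases q with
    | zero => simp [dchain]
    | succ q =>
      have h : (dchain t (q + 1)).Sublist (k :: α) ↔
          (q + 1 ≤ cnt t α ∨ (k = SIdx.succ^[q] t ∧ q ≤ cnt t α)) := by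
        rw [← ih, ← ih]
        constructor
        · intro h
          rw [dchain] at h ⊢
          cases h with
          | cons _ h => exact Or.inl h
          | cons_cons _ h => exact Or.inr ⟨rfl, h⟩
        · rintro (h | ⟨h1, h2⟩)
          · exact h.cons _
          · rw [dchain, h1]; exact h2.cons_cons _
      rw [h, cnt]
      split_ifs with hk
      · constructor
        · rintro (h | ⟨_, h⟩) <;> omega
        · intro h
          by_cases hq : q = cnt t α
          · right; subst hq; exact ⟨hk, le_rfl⟩
          · left; omega
      · constructor
        · rintro (h | ⟨h1, h⟩)
          · exact h
          · have : q ≠ cnt t α := by rintro rfl; exact hk h1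
            omega
        · intro h; exact Or.inl h

theorem cnt_le_length (t : SIdx) (α : List SIdx) : cnt t α ≤ α.length := by
  have := ((dchain_sublist t α (cnt t α)).2 le_rfl).length_le
  rwa [dchain_length] at this

theorem mem_of_lt_cnt (t : SIdx) (α : List SIdx) (c : ℕ) (h : c < cnt t α) :
    SIdx.succ^[c] t ∈ α :=
  ((dchain_sublist t α (c + 1)).2 h).subset (by simp [dchain])

theorem mem_iff_cnt (t : SIdx) (α : List SIdx) : t ∈ α ↔ 1 ≤ cnt t α := by
  rw [← dchain_sublist]; simp [dchain]

theorem invsAt_eq (α : List SIdx) (t : SIdx) : invsAt α t = (cnt t α : ℤ) - 1 := by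
  unfold invsAt
  split_ifs with h
  · have h1 := (mem_iff_cnt t α).1 h
    have h2 := cnt_le_length t α
    have : @Nat.findGreatest (fun p : ℕ => ((chainUp t p).reverse).Sublist α)
        (Classical.decPred _) α.length = cnt t α - 1 := by
      refine (@Nat.findGreatest_eq_iff _ _ _ (Classical.decPred _)).2 ?_
      refine ⟨by omega, ?_, ?_⟩
      · intro _; rw [chainUp_reverse, dchain_sublist]; omega
      · intro k hk _; rw [chainUp_reverse, dchain_sublist]; omega
    rw [this]; omega
  · have : ¬ 1 ≤ cnt t α := fun h' => h ((mem_iff_cnt t α).2 h')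
    omega

theorem chainUp_length (p : ℕ) : ∀ t : SIdx, (chainUp t p).length = p + 1 := by
  induction p with
  | zero => intro t; rfl
  | succ p ih => intro t; simp [chainUp, ih]

theorem consAt_spec (α : List SIdx) (t : SIdx) (h : t ∈ α) :
    ∃ c : ℕ, consAt α t = c ∧ (chainUp t c).Sublist α ∧ ¬ (chainUp t (c + 1)).Sublist α := by
  classical
  unfold consAt
  rw [if_pos h]
  refine ⟨_, rfl, ?_, ?_⟩
  · exact @Nat.findGreatest_spec 0 (fun p : ℕ => (chainUp t p).Sublist α) (Classical.decPred _)
      α.length (Nat.zero_le _) (by simpa [chainUp] using h)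
  · intro hs
    have hl := hs.length_le
    rw [chainUp_length] at hl
    have := @Nat.le_findGreatest _ (fun p : ℕ => (chainUp t p).Sublist α) (Classical.decPred _)
      α.length (by omega) hs
    omega

theorem cnt_append (t : SIdx) (α β : List SIdx) :
    cnt t (α ++ β) = cnt t β + cnt (SIdx.succ^[cnt t β] t) α := by
  induction α with
  | nil => simp [cnt]
  | cons k α ih =>
    simp only [List.cons_append, cnt, ih, ← Function.iterate_add_apply]
    rw [add_comm (cnt t β)]
    split_ifs <;> omega

theorem succ_inj {a b : SIdx} (h : a.succ = b.succ) : a = b := by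
  rcases a with _ | _ | _ <;> rcases b with _ | _ | _ <;> simp_all [SIdx.succ]

theorem sip_split {α : List SIdx} (h : SIP α) (u v w : List SIdx) (k : SIdx)
    (e : α = u ++ k :: (v ++ k :: w)) : k.succ ∈ v := by
  subst e
  obtain ⟨⟨c, hc⟩, h1, h2, h3⟩ := h ⟨u.length, by simp⟩ ⟨u.length + 1 + v.length, by simp; omega⟩
    (by simp [Fin.lt_def]; omega) (by
      simp only [List.get_eq_getElem]
      rw [List.getElem_append_right (by simp), List.getElem_append_right (by omega)]
      simp [show u.length + 1 + v.length - u.length = v.length + 1 by omega])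
  simp only [Fin.lt_def] at h1 h2
  simp only [List.get_eq_getElem] at h3
  obtain ⟨d, rfl⟩ : ∃ d, c = u.length + (d + 1) := ⟨c - u.length - 1, by omega⟩
  have hd : d < v.length := by omega
  rw [List.getElem_append_right (by omega), List.getElem_append_right (by simp)] at h3
  simp only [Nat.add_sub_cancel_left, List.getElem_cons_succ, Nat.sub_self,
    List.getElem_cons_zero] at h3
  rw [List.getElem_append_left hd] at h3
  rw [← h3]
  exact List.getElem_mem _

theorem sip_prefix {α β : List SIdx} (h : SIP (α ++ β)) : SIP α := by
  intro a b hab hEq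
  obtain ⟨c, h1, h2, h3⟩ := h ⟨a, by simp; omega⟩ ⟨b, by simp; omega⟩ hab
    (by simpa [List.get_eq_getElem] using hEq)
  have hc : (c : ℕ) < α.length := lt_trans (Fin.lt_def.1 h2) b.2
  refine ⟨⟨c, hc⟩, h1, h2, ?_⟩
  simpa [List.get_eq_getElem, List.getElem_append_left hc] using h3

theorem cnt_split (t : SIdx) (c : ℕ) (v : List SIdx) : cnt t v = c + 1 →
    ∃ v1 v2, v = v1 ++ SIdx.succ^[c] t :: v2 ∧ SIdx.succ^[c + 1] t ∉ v1 := by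
  induction v with
  | nil => intro h; simp [cnt] at h
  | cons k v ih =>
    intro h
    rw [cnt] at h
    split_ifs at h with hk
    · obtain rfl : cnt t v = c := by omega
      exact ⟨[], v, by simp [hk], by simp⟩
    · obtain ⟨v1, v2, rfl, h2⟩ := ih h
      rw [h] at hk
      exact ⟨k :: v1, v2, rfl, by simp only [List.mem_cons, not_or]; exact ⟨fun h => hk h.symm, h2⟩⟩

theorem sip_good {α : List SIdx} (h : SIP α) (t : SIdx) (u v : List SIdx) (k : SIdx)
    (e : α = u ++ k :: v) (hc : 1 ≤ cnt t v) : k.succ ≠ SIdx.succ^[cnt t v] t := by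
  intro hk
  obtain ⟨c, hc'⟩ : ∃ c, cnt t v = c + 1 := ⟨cnt t v - 1, by omega⟩
  obtain ⟨v1, v2, rfl, h2⟩ := cnt_split t c v hc'
  rw [hc'] at hk
  have hk' : k = SIdx.succ^[c] t := by
    rw [Function.iterate_succ_apply'] at hk
    exact succ_inj hk
  have := sip_split h u v1 v2 k (by rw [e, ← hk'])
  rw [hk] at this
  exact h2 this

theorem iter_pos (a c : ℕ) : SIdx.succ^[c] (.pos a) = .pos (a + c) := by
  induction c with
  | zero => rfl
  | succ c ih => rw [Function.iterate_succ_apply', ih]; rfl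

theorem iter_neg (a c : ℕ) (h : c ≤ a) : SIdx.succ^[c] (.neg a) = .neg (a - c) := by
  induction c with
  | zero => rfl
  | succ c ih =>
    rw [Function.iterate_succ_apply', ih (by omega),
      show a - c = (a - (c + 1)) + 1 by omega]; rfl

theorem prod_pos {m n : ℕ} (a : ℕ) (ha : a < m) (α : List SIdx) :
    ∀ Xs : List (Matrix (Fin n) (Fin n) ℂ), α.length = Xs.length →
    (∀ k ∈ α, k.isNeg = false ∧ k.val + 2 ≤ m) →
    (∀ u k v, α = u ++ k :: v →
      k.succ ≠ SIdx.succ^[cnt (.pos (a + 1)) v] (.pos (a + 1))) →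
    a + cnt (.pos (a + 1)) α < m ∧
    prodAssign m n α Xs * colSel m n ((m : ℤ) - (a : ℤ)) =
      colSel m n ((m : ℤ) - ((a + cnt (.pos (a + 1)) α : ℕ) : ℤ)) := by
  induction α with
  | nil => intro Xs _ _ _; simp [prodAssign, cnt, ha]
  | cons k α ih =>
    intro Xs hX hmem hgood
    cases Xs with
    | nil => simp at hX
    | cons X Xs =>
      obtain ⟨i1, i2⟩ := ih Xs (by simpa using hX) (fun k hk => hmem k (by simp [hk]))
        (fun u k' v e => hgood (k :: u) k' v (by simp [e]))
      obtain ⟨k1, k2⟩ := hmem k (by simp)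
      have hg := hgood [] k α rfl
      rw [prod_cons, Matrix.mul_assoc, i2, cnt]
      rw [iter_pos] at hg ⊢
      rcases k with k | k
      · simp only [SIdx.val, SIdx.succ, SIdx.pos.injEq, ne_eq] at k2 hg ⊢
        split_ifs with hk
        · refine ⟨by omega, ?_⟩
          have := elem_pos (m := m) (n := n) k (by omega) (by omega) X
          rw [show k - 1 = a + cnt (.pos (a + 1)) α by omega] at this
          rw [this]
          congr 2
          omega
        · refine ⟨i1, ?_⟩
          apply elem_id <;> (try simp only [SIdx.val]) <;> omega
      · simp [SIdx.isNeg] at k1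

theorem prod_neg {m n : ℕ} (a : ℕ) (ha : a < m) (α : List SIdx) :
    ∀ Xs : List (Matrix (Fin n) (Fin n) ℂ), α.length = Xs.length →
    (∀ k ∈ α, k.isNeg = true ∧ 2 ≤ k.val ∧ k.val ≤ m) →
    (∀ u k v, α = u ++ k :: v →
      k.succ ≠ SIdx.succ^[cnt (.neg a) v] (.neg a)) →
    cnt (.neg a) α ≤ a ∧
    prodAssign m n α Xs * colSel m n ((m : ℤ) - (a : ℤ)) =
      colSel m n ((m : ℤ) - ((a - cnt (.neg a) α : ℕ) : ℤ)) := by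
  induction α with
  | nil => intro Xs _ _ _; simp [prodAssign, cnt]
  | cons k α ih =>
    intro Xs hX hmem hgood
    cases Xs with
    | nil => simp at hX
    | cons X Xs =>
      obtain ⟨i1, i2⟩ := ih Xs (by simpa using hX) (fun k hk => hmem k (by simp [hk]))
        (fun u k' v e => hgood (k :: u) k' v (by simp [e]))
      obtain ⟨k1, k2, k3⟩ := hmem k (by simp)
      have hg := hgood [] k α rfl
      rw [prod_cons, Matrix.mul_assoc, i2, cnt]
      rw [iter_neg _ _ i1] at hg ⊢
      rcases k with k | k
      · simp [SIdx.isNeg] at k1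
      · simp only [SIdx.val] at k2 k3
        obtain ⟨j, rfl⟩ : ∃ j, k = j + 1 := ⟨k - 1, by omega⟩
        simp only [SIdx.succ, SIdx.neg.injEq, ne_eq] at hg ⊢
        split_ifs with hk
        · refine ⟨by omega, ?_⟩
          have := elem_neg (m := m) (n := n) (j + 1) (by omega) (by omega) X
          rw [← hk, this]
          congr 3
          omega
        · refine ⟨i1, ?_⟩
          apply elem_id <;> (try simp only [SIdx.val]) <;> omega

variable {m n : ℕ}

theorem sig_form (E : EGFPData m n) {k : SIdx} (h : k ∈ E.sig) : k = .pos k.val := by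
  have := E.hsigpos k h
  cases k <;> simp_all [SIdx.isNeg, SIdx.val]

theorem tau_form (E : EGFPData m n) {k : SIdx} (h : k ∈ E.tau) : k = .neg k.val := by
  have := E.htauneg k h
  cases k <;> simp_all [SIdx.isNeg, SIdx.val]

theorem perm_nodup (E : EGFPData m n) :
    (E.sig.map SIdx.val ++ E.tau.map SIdx.val).Nodup :=
  E.hperm.nodup_iff.2 List.nodup_range

theorem disj (E : EGFPData m n) {i : ℕ} (h1 : SIdx.pos i ∈ E.sig) (h2 : SIdx.neg i ∈ E.tau) :
    False := by
  have := (List.nodup_append.1 (perm_nodup E)).2.2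
  exact this i (List.mem_map.2 ⟨_, h1, rfl⟩) i (List.mem_map.2 ⟨_, h2, rfl⟩) rfl

theorem sig_le (E : EGFPData m n) {k : SIdx} (h : k ∈ E.sig) : k.val ≤ m := by
  have : k.val ∈ List.range (m + 1) :=
    E.hperm.subset (List.mem_append_left _ (List.mem_map.2 ⟨_, h, rfl⟩))
  simp at this; omega

theorem tau_le (E : EGFPData m n) {k : SIdx} (h : k ∈ E.tau) : k.val ≤ m := by
  have : k.val ∈ List.range (m + 1) :=
    E.hperm.subset (List.mem_append_right _ (List.mem_map.2 ⟨_, h, rfl⟩))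
  simp at this; omega

theorem cover (E : EGFPData m n) {i : ℕ} (h : i ≤ m) :
    SIdx.pos i ∈ E.sig ∨ SIdx.neg i ∈ E.tau := by
  have : i ∈ E.sig.map SIdx.val ++ E.tau.map SIdx.val :=
    E.hperm.symm.subset (by simp; omega)
  rcases List.mem_append.1 this with h | h <;> obtain ⟨k, hk, rfl⟩ := List.mem_map.1 h
  · left; rw [← sig_form E hk]; exact hk
  · right; rw [← tau_form E hk]; exact hk

theorem chainUp_snoc (c : ℕ) : ∀ a, chainUp (.pos a) (c + 1) = chainUp (.pos a) c ++ [.pos (a + c + 1)] := by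
  induction c with
  | zero => intro a; rfl
  | succ c ih =>
    intro a
    rw [chainUp, SIdx.succ, ih, chainUp, SIdx.succ, List.cons_append]
    congr 4
    omega

theorem mem_chainUp (c : ℕ) (j : ℕ) (h : j ≤ c) : SIdx.pos j ∈ chainUp (.pos 0) c := by
  induction c with
  | zero => obtain rfl : j = 0 := by omega
            simp [chainUp]
  | succ c ih =>
    rw [chainUp_snoc]
    by_cases hj : j = c + 1
    · simp [hj]
    · exact List.mem_append_left _ (ih (by omega))

theorem chainUp_last (c : ℕ) : ∃ l, chainUp (.pos 0) c = l ++ [.pos c] := by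
  cases c with
  | zero => exact ⟨[], rfl⟩
  | succ c => exact ⟨_, by rw [chainUp_snoc, Nat.zero_add]⟩

/-- If the chain stops at `c`, then `c` is not before `c+1`. -/
theorem order_lemma (ω l1 l2 : List SIdx) (c : ℕ) (hnd : ω.Nodup)
    (e : ω = l1 ++ .pos (c + 1) :: l2) (h1 : (chainUp (.pos 0) c).Sublist ω)
    (h2 : ¬ (chainUp (.pos 0) (c + 1)).Sublist ω) : SIdx.pos c ∉ l1 := by
  intro hc
  apply h2
  subst e
  rw [chainUp_snoc, Nat.zero_add]
  obtain ⟨x, y, hxy, hx, hy⟩ := List.sublist_append_iff.1 h1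
  rcases List.eq_nil_or_concat y with rfl | ⟨y', b, rfl⟩
  · rw [hxy, List.append_nil]
    exact hx.append (by simp)
  · exfalso
    obtain ⟨l, hl⟩ := chainUp_last c
    rw [hl] at hxy
    have hb : b = .pos c := by
      have := congrArg List.getLast? hxy
      simpa using this.symm
    have hm : SIdx.pos c ∈ SIdx.pos (c + 1) :: l2 := hy.subset (by simp [hb])
    exact (List.nodup_append.1 hnd).2.2 _ hc _ hm rfl

/-- `−(p+1)` cannot be in `τ₁` unless `−p ∈ τ`; in fact, `−p` occurs between. -/
theorem tau1_between (E : EGFPData m n) {k : SIdx} (u v u' v' : List SIdx)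
    (h1 : E.tau1 = u ++ k :: v) (h2 : E.tau = u' ++ k :: v') : k.succ ∈ v ++ u' := by
  apply sip_split E.hSIPtau u (v ++ u') (v' ++ E.tau2) k
  rw [h1, h2]; simp

end EGFPAux

open EGFPAux in
/-- **Lemma on column selection, `0 ∈ ω`, where `ω = −τ`.**
With `c₀ := c₀(ω)` and `Lf := M_{τ₁}(Y₁) M_{σ₁}(X₁)`:
(a) if `c₀+1 ∈ σ` and `s := c₀ + i_{c₀+1}(σ) + 1 < m` then
`Lf (e_{m−s} ⊗ I_n) = e_{m−p} ⊗ I_n` with `p = c₀ + i_{c₀+1}(σ₁,σ) + 1`;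
(b) if `c₀+1 ∈ σ` and `s = m` then `Lf (e_1 ⊗ I_n) = e_p ⊗ I_n` with
`p = i_{−(m−1)}(τ₁) + 2`;
(c) if `c₀ < m` and `c₀+1 ∉ σ` then `Lf (e_{m−c₀} ⊗ I_n) = e_{m−p} ⊗ I_n` with
`p = c₀ − i_{−c₀}(τ₁) − 1`;
(d) if `c₀ = m` then `Lf (e_m ⊗ I_n) = e_m ⊗ I_n`. -/
theorem egfp_col_selection_omega {m n : ℕ} (E : EGFPData m n)
    (h0 : SIdx.neg 0 ∈ E.tau) :
    let ω := E.tau.map SIdx.negate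
    let Lf := prodAssign m n E.tau1 E.Y1 * prodAssign m n E.sig1 E.X1
    let c0 := consAt ω (.pos 0)
    (SIdx.pos (c0.toNat + 1) ∈ E.sig →
      c0 + invsAt E.sig (.pos (c0.toNat + 1)) + 1 < (m : ℤ) →
      Lf * colSel m n ((m : ℤ) - (c0 + invsAt E.sig (.pos (c0.toNat + 1)) + 1)) =
        colSel m n ((m : ℤ) - (c0 + invsAt (E.sig1 ++ E.sig) (.pos (c0.toNat + 1)) + 1))) ∧
    (SIdx.pos (c0.toNat + 1) ∈ E.sig →
      c0 + invsAt E.sig (.pos (c0.toNat + 1)) + 1 = (m : ℤ) →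
      Lf * colSel m n 1 = colSel m n (invsAt E.tau1 (.neg (m - 1)) + 2)) ∧
    (c0 < (m : ℤ) → SIdx.pos (c0.toNat + 1) ∉ E.sig →
      Lf * colSel m n ((m : ℤ) - c0) =
        colSel m n ((m : ℤ) - (c0 - invsAt E.tau1 (.neg c0.toNat) - 1))) ∧
    (c0 = (m : ℤ) → Lf * colSel m n (m : ℤ) = colSel m n (m : ℤ)) := by
  obtain ⟨c, hc, hc1, hc2⟩ := consAt_spec (E.tau.map SIdx.negate) (.pos 0)
    (List.mem_map.2 ⟨_, h0, rfl⟩)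
  have htau : ∀ j ≤ c, SIdx.neg j ∈ E.tau := by
    intro j hj
    obtain ⟨k, hk, hk'⟩ := List.mem_map.1 (hc1.subset (mem_chainUp c j hj))
    cases k <;> simp [SIdx.negate] at hk'
    subst hk'; exact hk
  have hndt : (E.tau.map SIdx.negate).Nodup := by
    apply (List.Nodup.of_map SIdx.val (List.nodup_append.1 (perm_nodup E)).2.1).map
    intro a b hab
    cases a <;> cases b <;> simp_all [SIdx.negate]
  have hcm : c ≤ m := tau_le E (htau c le_rfl)
  have hm := E.hm
  have hsipt1 : SIP E.tau1 := sip_prefix (sip_prefix E.hSIPtau)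
  have hsips : SIP (E.sig1 ++ E.sig) := sip_prefix E.hSIPsig
  have htau1mem : ∀ k ∈ E.tau1, k.isNeg = true ∧ 2 ≤ k.val ∧ k.val ≤ m := fun k hk =>
    ⟨E.htauneg k (E.htau1 k hk).1, (E.htau1 k hk).2, tau_le E (E.htau1 k hk).1⟩
  intro ω Lf c0
  have hc0 : c0 = (c : ℤ) := hc
  clear_value c0
  subst hc0
  simp only [Int.toNat_natCast, invsAt_eq]
  refine ⟨?_, ?_, ?_, ?_⟩
  · intro hsig hlt
    have hq := (mem_iff_cnt _ _).1 hsig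
    set q := cnt (.pos (c + 1)) E.sig with hqdef
    have hstart : SIdx.succ^[q] (.pos (c + 1)) = .pos (c + q + 1) := by
      rw [iter_pos]; congr 1; omega
    have happ : cnt (.pos (c + 1)) (E.sig1 ++ E.sig) =
        q + cnt (.pos (c + q + 1)) E.sig1 := by
      rw [cnt_append, ← hqdef, hstart]
    obtain ⟨p1, p2⟩ := prod_pos (n := n) (c + q) (by omega) E.sig1 E.X1 E.hX1.1
      (fun k hk => ⟨E.hsigpos k (E.hsig1 k hk).1, (E.hsig1 k hk).2⟩) (by
        intro u k v e
        have h1 := sip_good hsips (.pos (c + 1)) u (v ++ E.sig) k (by rw [e]; simp)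
          (by rw [cnt_append]; omega)
        rw [cnt_append, ← hqdef, add_comm q, Function.iterate_add_apply, hstart] at h1
        exact h1)
    set r := cnt (.pos (c + q + 1)) E.sig1 with hr
    have hp : SIdx.pos (c + q + r) ∈ E.sig := by
      have := mem_of_lt_cnt (.pos (c + 1)) (E.sig1 ++ E.sig) (q + r - 1) (by omega)
      rw [iter_pos, show c + 1 + (q + r - 1) = c + q + r by omega] at this
      rcases List.mem_append.1 this with h | h
      · exact (E.hsig1 _ h).1
      · exact h
    rw [show (m : ℤ) - ((c : ℤ) + ((q : ℤ) - 1) + 1) = (m : ℤ) - ((c + q : ℕ) : ℤ) by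
      push_cast; ring, happ,
      show (m : ℤ) - ((c : ℤ) + (((q + r : ℕ) : ℤ) - 1) + 1) = (m : ℤ) - ((c + q + r : ℕ) : ℤ) by
      push_cast; ring]
    simp only [Lf]
    rw [Matrix.mul_assoc, p2]
    apply prod_id _ p1
    intro k hk
    have hkt := (E.htau1 k hk).1
    refine ⟨tau_le E hkt, ?_, ?_⟩
    · intro h
      rw [tau_form E hkt, h] at hkt
      exact disj E hp hkt
    · intro h
      obtain ⟨u, v, e1⟩ := List.append_of_mem hk
      obtain ⟨u', v', e2⟩ := List.append_of_mem hkt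
      have hb := tau1_between E u v u' v' e1 e2
      have hks : k.succ = .neg (c + q + r) := by
        rw [tau_form E hkt, h]; rfl
      rw [hks] at hb
      apply disj E hp
      rcases List.mem_append.1 hb with h | h
      · exact (E.htau1 _ (by rw [e1]; simp [h])).1
      · rw [e2]; simp [h]
  · intro hsig hs
    have hq := (mem_iff_cnt _ _).1 hsig
    have hmsig : SIdx.pos m ∈ E.sig := by
      have := mem_of_lt_cnt (.pos (c + 1)) E.sig (cnt (.pos (c + 1)) E.sig - 1) (by omega)
      rw [iter_pos] at this
      convert this using 2
      omega
    obtain ⟨p1, p2⟩ := prod_neg (n := n) (m - 1) (by omega) E.tau1 E.Y1 E.hY1.1 htau1mem (by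
      intro u k v e
      by_cases hv : 1 ≤ cnt (.neg (m - 1)) v
      · exact sip_good hsipt1 _ u v k e hv
      · rw [show cnt (.neg (m - 1)) v = 0 by omega]
        intro hk
        have hkt := (E.htau1 k (by rw [e]; simp)).1
        have : k = .neg m := by
          apply succ_inj
          rw [hk, show m = m - 1 + 1 by omega]; rfl
        rw [this] at hkt
        exact disj E hmsig hkt)
    rw [show (1 : ℤ) = (m : ℤ) - ((m - 1 : ℕ) : ℤ) by omega]
    simp only [Lf]
    rw [Matrix.mul_assoc, prod_id (m - 1) (by omega) E.sig1 E.X1, p2]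
    · congr 1
      omega
    · intro k hk
      have := (E.hsig1 k hk).2
      refine ⟨?_, ?_, ?_⟩ <;> omega
  · intro hlt hsig
    have hlt' : c < m := by omega
    have hct : SIdx.neg (c + 1) ∈ E.tau := (cover E (by omega)).resolve_left hsig
    obtain ⟨p1, p2⟩ := prod_neg (n := n) c hlt' E.tau1 E.Y1 E.hY1.1 htau1mem (by
      intro u k v e
      by_cases hv : 1 ≤ cnt (.neg c) v
      · exact sip_good hsipt1 _ u v k e hv
      · have hv' := mt (mem_iff_cnt (.neg c) v).1 hv
        rw [show cnt (.neg c) v = 0 by omega]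
        intro hk
        have : k = .neg (c + 1) := succ_inj hk
        subst this
        obtain ⟨u', v', e2⟩ := List.append_of_mem hct
        have hb := tau1_between E u v u' v' e e2
        have hb' : SIdx.neg c ∈ u' := by
          rcases List.mem_append.1 hb with h | h
          · exact absurd h hv'
          · exact h
        exact order_lemma _ (u'.map SIdx.negate) (v'.map SIdx.negate) c hndt
          (by rw [e2]; simp [SIdx.negate]) hc1 hc2 (List.mem_map.2 ⟨_, hb', rfl⟩))
    simp only [Lf]
    rw [Matrix.mul_assoc, prod_id c hlt' E.sig1 E.X1, p2]
    · congr 1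
      omega
    · intro k hk
      have hks := (E.hsig1 k hk).1
      refine ⟨sig_le E hks, ?_, ?_⟩
      · intro h
        rw [sig_form E hks, h] at hks
        exact disj E hks (htau c le_rfl)
      · intro h
        rw [sig_form E hks, h] at hks
        exact hsig hks
  · intro hcm'
    have hcm'' : c = m := by omega
    rw [show (m : ℤ) = (m : ℤ) - ((0 : ℕ) : ℤ) by simp]
    simp only [Lf]
    rw [Matrix.mul_assoc, prod_id 0 (by omega) E.sig1 E.X1, prod_id 0 (by omega) E.tau1 E.Y1]
    · intro k hk
      have := (htau1mem k hk).2
      refine ⟨?_, ?_, ?_⟩ <;> omega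
    · intro k hk
      exfalso
      have hks := (E.hsig1 k hk).1
      have hle := sig_le E hks
      rw [sig_form E hks] at hks
      exact disj E hks (htau _ (by omega))
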